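/- arXiv:2112.14007 — 5 statements merged into one kernel-verified Lean document; each statement's English description precedes it below -/
import Mathlib

section
/- Let A be a C*-algebra and let τ : A → ℂ be a continuous function such that (i) τ(x + y) = τ(x) + τ(y) whenever x and y are commuting self-adjoint elements of A, (ii) τ(c·x) = c·τ(x) for every real number c and every self-adjoint x ∈ A, and (iii) τ(x*x) = τ(xx*) for all x ∈ A. Let e ∈ A with 0 ≤ e and let a ∈ A satisfy ea = a = ae. Then for every continuous function f : ℝ → ℝ with f(0) = 0 one has τ(f(e − a*a)) = τ(f(e − aa*)), where f(·) is applied to the self-adjoint elements e − a*a and e − aa* by (non-unital) continuous functional calculus. In particular, τ((e − a*a)^n) = τ((e − aa*)^n) for every integer n ≥ 1. -/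
open scoped ComplexOrder

/-- `npow1 x n = x ^ (n + 1)`, powers with positive exponent in a (possibly non-unital)
multiplicative structure. -/
def npow1 {A : Type*} [Mul A] (x : A) : ℕ → A
  | 0 => x
  | n + 1 => npow1 x n * x

section

open Polynomial Filter Topology

variable {A : Type*} [NonUnitalCStarAlgebra A]

lemma cfcₙ_pow_succ_eq_npow1 {x : A} (hx : IsSelfAdjoint x) (m : ℕ) :
    cfcₙ (fun t : ℝ ↦ t ^ (m + 1)) x = npow1 x m := by
  induction m with
  | zero => simp [npow1, cfcₙ_id' ℝ x]
  | succ m ih =>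
    simp_rw [pow_succ _ (m + 1)]
    rw [cfcₙ_mul (fun t : ℝ ↦ t ^ (m + 1)) (fun t ↦ t) x, ih, cfcₙ_id' ℝ x, npow1]

lemma npow1_mul_star_self_succ (a : A) (m : ℕ) :
    npow1 (a * star a) (m + 1) = a * npow1 (star a * a) m * star a := by
  induction m with
  | zero => simp [npow1, mul_assoc]
  | succ m ih => rw [npow1, ih, npow1]; simp only [mul_assoc]

lemma npow1_mul_eq_of_mul_eq {e x : A} (h : e * x = x) (m : ℕ) : npow1 e m * x = x := by
  induction m with
  | zero => exact h
  | succ m ih => rw [npow1, mul_assoc, h, ih]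

/-- If `e` acts as a unit on `x`, then `(e - x) ^ (m + 1) - e ^ (m + 1)` is a function of `x` which
does not depend on `x`, and on which `e` still acts as a unit. -/
lemma exists_npow1_sub_eq_add_cfcₙ (e : A) (m : ℕ) :
    ∃ q : ℝ → ℝ, Continuous q ∧ q 0 = 0 ∧ ∀ x : A, IsSelfAdjoint x → e * x = x → x * e = x →
      npow1 (e - x) m = npow1 e m + cfcₙ q x ∧
        e * cfcₙ q x = cfcₙ q x ∧ cfcₙ q x * e = cfcₙ q x := by
  induction m with
  | zero =>
    refine ⟨fun t ↦ -t, by fun_prop, by simp, fun x hx h₁ h₂ ↦ ?_⟩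
    rw [cfcₙ_neg_id (R := ℝ) x]
    simp [npow1, h₁, h₂, sub_eq_add_neg]
  | succ m ih =>
    obtain ⟨q, hq, hq0, h⟩ := ih
    refine ⟨fun t ↦ q t - q t * t - t, by fun_prop, by simp [hq0], fun x hx h₁ h₂ ↦ ?_⟩
    obtain ⟨h₃, h₄, h₅⟩ := h x hx h₁ h₂
    rw [cfcₙ_sub (fun t ↦ q t - q t * t) (fun t ↦ t) x, cfcₙ_sub q (fun t ↦ q t * t) x,
      cfcₙ_mul q (fun t ↦ t) x, cfcₙ_id' ℝ x]
    refine ⟨?_, ?_, ?_⟩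
    · rw [npow1, h₃, npow1, mul_sub, add_mul, add_mul, h₅, npow1_mul_eq_of_mul_eq h₁]
      abel
    · simp only [mul_sub, ← mul_assoc, h₁, h₄]
    · simp only [sub_mul, mul_assoc, h₂, h₅]

variable {τ : A → ℂ}

lemma map_npow1_star_mul_self [PartialOrder A] [StarOrderedRing A]
    (htrace : ∀ x : A, τ (star x * x) = τ (x * star x)) (a : A) (m : ℕ) :
    τ (npow1 (star a * a) m) = τ (npow1 (a * star a) m) := by
  cases m with
  | zero => exact htrace a
  | succ m =>
    set h := star a * a with hh
    have hsa : IsSelfAdjoint h := .star_mul_self a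
    set s := cfcₙ (fun t : ℝ ↦ √(t ^ (m + 1))) h with hs
    have hs_sa : star s = s := (cfcₙ_predicate (R := ℝ) _ h).star_eq
    have hss : s * s = npow1 h m := by
      rw [hs, ← cfcₙ_mul _ _ h, ← cfcₙ_pow_succ_eq_npow1 hsa]
      refine cfcₙ_congr fun t ht ↦ ?_
      have := quasispectrum_nonneg_of_nonneg h (star_mul_self_nonneg a) t ht
      exact Real.mul_self_sqrt (by positivity)
    have hcomm : h * s = s * h := by
      simpa [cfcₙ_id' ℝ h] using (cfcₙ_commute_cfcₙ (fun t : ℝ ↦ t) _ h).eq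
    have key := htrace (a * s)
    rw [star_mul, hs_sa] at key
    have e₁ : s * star a * (a * s) = npow1 h (m + 1) := by
      rw [npow1, ← hss, mul_assoc, ← mul_assoc (star a), ← hh, hcomm, mul_assoc]
    have e₂ : a * s * (s * star a) = npow1 (a * star a) (m + 1) := by
      rw [npow1_mul_star_self_succ, ← hh, ← hss]
      simp only [mul_assoc]
    rwa [e₁, e₂] at key

/-- A functional which is linear on commuting self-adjoint elements and agrees on the powers of two
self-adjoint elements agrees on their polynomials without constant term. -/
lemma map_cfcₙ_mul_eval_eq
    (hadd : ∀ x y : A, IsSelfAdjoint x → IsSelfAdjoint y → Commute x y → τ (x + y) = τ x + τ y)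
    (hsmul : ∀ (c : ℝ) (x : A), IsSelfAdjoint x → τ (c • x) = c • τ x)
    {x y : A} (hx : IsSelfAdjoint x) (hy : IsSelfAdjoint y)
    (h : ∀ m, τ (npow1 x m) = τ (npow1 y m)) (p : ℝ[X]) :
    τ (cfcₙ (fun t ↦ t * p.eval t) x) = τ (cfcₙ (fun t ↦ t * p.eval t) y) := by
  induction p using Polynomial.induction_on' with
  | add p q hp hq =>
    have aux (z : A) : τ (cfcₙ (fun t ↦ t * (p + q).eval t) z) =
        τ (cfcₙ (fun t ↦ t * p.eval t) z) + τ (cfcₙ (fun t ↦ t * q.eval t) z) := by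
      simp_rw [eval_add, mul_add]
      rw [cfcₙ_add (fun t ↦ t * p.eval t) (fun t ↦ t * q.eval t) z]
      exact hadd _ _ (cfcₙ_predicate _ z) (cfcₙ_predicate _ z) (cfcₙ_commute_cfcₙ _ _ z)
    rw [aux, aux, hp, hq]
  | monomial n c =>
    have aux {z : A} (hz : IsSelfAdjoint z) :
        τ (cfcₙ (fun t ↦ t * (monomial n c).eval t) z) = c • τ (npow1 z n) := by
      have : (fun t : ℝ ↦ t * (monomial n c).eval t) = fun t ↦ c * t ^ (n + 1) := by
        ext t
        rw [eval_monomial]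
        ring
      rw [this, cfcₙ_const_mul c (fun t ↦ t ^ (n + 1)) z, hsmul _ _ (cfcₙ_predicate _ z),
        cfcₙ_pow_succ_eq_npow1 hz]
    rw [aux hx, aux hy, h]

lemma exists_seq_polynomial_tendstoUniformlyOn {f : ℝ → ℝ} (hf : Continuous f) (hf0 : f 0 = 0)
    {r : ℝ} (hr : 0 ≤ r) :
    ∃ p : ℕ → ℝ[X],
      TendstoUniformlyOn (fun n t ↦ t * (p n).eval t) f atTop (Set.Icc (-r) r) := by
  have hpos (n : ℕ) : (0 : ℝ) < 1 / (n + 1) / 2 := by positivity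
  choose P hP using fun n ↦ exists_polynomial_near_of_continuousOn (-r) r f hf.continuousOn _
    (hpos n)
  refine ⟨fun n ↦ (P n).divX, Metric.tendstoUniformlyOn_iff.2 fun ε hε ↦ ?_⟩
  filter_upwards [tendsto_one_div_add_atTop_nhds_zero_nat.eventually (gt_mem_nhds hε)] with n hn t ht
  have h₁ := hP n t ht
  have h₂ := hP n 0 ⟨by linarith, hr⟩
  have h₃ : (P n).eval t = t * (P n).divX.eval t + (P n).eval 0 := by
    conv_lhs => rw [← X_mul_divX_add (P n)]
    simp [coeff_zero_eq_eval_zero]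
  rw [hf0] at h₂
  rw [Real.dist_eq, abs_lt]
  rw [abs_lt] at h₁ h₂
  constructor <;> linarith

/-- A continuous functional which is linear on commuting self-adjoint elements and agrees on the
powers of two self-adjoint elements agrees on their continuous functional calculi. -/
lemma map_cfcₙ_eq_of_map_npow1_eq (hτ : Continuous τ)
    (hadd : ∀ x y : A, IsSelfAdjoint x → IsSelfAdjoint y → Commute x y → τ (x + y) = τ x + τ y)
    (hsmul : ∀ (c : ℝ) (x : A), IsSelfAdjoint x → τ (c • x) = c • τ x)
    {x y : A} (hx : IsSelfAdjoint x) (hy : IsSelfAdjoint y)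
    (h : ∀ m, τ (npow1 x m) = τ (npow1 y m)) {f : ℝ → ℝ} (hf : Continuous f) (hf0 : f 0 = 0) :
    τ (cfcₙ f x) = τ (cfcₙ f y) := by
  obtain ⟨p, hp⟩ := exists_seq_polynomial_tendstoUniformlyOn hf hf0
    (le_max_of_le_left (norm_nonneg x) : 0 ≤ max ‖x‖ ‖y‖)
  have lim {z : A} (hz : IsSelfAdjoint z) (hle : ‖z‖ ≤ max ‖x‖ ‖y‖) :
      Tendsto (fun n ↦ τ (cfcₙ (fun t ↦ t * (p n).eval t) z)) atTop (𝓝 (τ (cfcₙ f z))) := by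
    refine (hτ.tendsto _).comp (tendsto_cfcₙ_fun (hp.mono fun t ht ↦ ?_) ?_ ?_)
    · exact abs_le.1 <|
        (NonUnitalIsometricContinuousFunctionalCalculus.norm_quasispectrum_le z ht hz).trans hle
    · exact .of_forall fun n ↦ by fun_prop
    · exact .of_forall fun n ↦ by simp
  refine tendsto_nhds_unique (lim hx (le_max_left _ _)) ?_
  simpa only [map_cfcₙ_mul_eval_eq hadd hsmul hx hy h] using lim hy (le_max_right _ _)

end

/-- For a (not necessarily unital) C*-algebra `A`,
a continuous functional `τ` which is additive on commuting self-adjoint elements,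
real-homogeneous on self-adjoint elements, and satisfies `τ(x*x) = τ(xx*)`
(these are properties of a 2-quasitrace), and elements `0 ≤ e`, `a` with `ea = a = ae`,
we have `τ(f(e - a*a)) = τ(f(e - aa*))` for every continuous `f : ℝ → ℝ` with `f 0 = 0`
(non-unital continuous functional calculus), and in particular
`τ((e - a*a)^n) = τ((e - aa*)^n)` for every integer `n ≥ 1`
(here `npow1 x m = x ^ (m+1)` ranges over all powers with exponent `n = m + 1 ≥ 1`). -/
theorem stmt0 {A : Type*} [NonUnitalCStarAlgebra A] [PartialOrder A] [StarOrderedRing A]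
    (τ : A → ℂ) (hτcont : Continuous τ)
    (hadd : ∀ x y : A, IsSelfAdjoint x → IsSelfAdjoint y → Commute x y →
      τ (x + y) = τ x + τ y)
    (hsmul : ∀ (c : ℝ) (x : A), IsSelfAdjoint x → τ (c • x) = c • τ x)
    (htrace : ∀ x : A, τ (star x * x) = τ (x * star x))
    (e a : A) (he : 0 ≤ e) (hea : e * a = a) (hae : a * e = a) :
    (∀ f : ℝ → ℝ, Continuous f → f 0 = 0 →
        τ (cfcₙ f (e - star a * a)) = τ (cfcₙ f (e - a * star a))) ∧
      ∀ m : ℕ, τ (npow1 (e - star a * a) m) = τ (npow1 (e - a * star a) m) := by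
  have hesa : star e = e := (IsSelfAdjoint.of_nonneg he).star_eq
  have hea' : e * star a = star a := by simpa [hesa] using congrArg star hae
  have hae' : star a * e = star a := by simpa [hesa] using congrArg star hea
  have hh := IsSelfAdjoint.star_mul_self a
  have hk := IsSelfAdjoint.mul_star_self a
  have hpow (m : ℕ) : τ (npow1 (e - star a * a) m) = τ (npow1 (e - a * star a) m) := by
    obtain ⟨q, hq, hq0, H⟩ := exists_npow1_sub_eq_add_cfcₙ e m
    have aux (x : A) (hx : IsSelfAdjoint x) (h₁ : e * x = x) (h₂ : x * e = x) :
        τ (npow1 (e - x) m) = τ (npow1 e m) + τ (cfcₙ q x) := by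
      obtain ⟨h₃, h₄, h₅⟩ := H x hx h₁ h₂
      have hcomm : Commute e (cfcₙ q x) := h₄.trans h₅.symm
      have hsa : IsSelfAdjoint (npow1 e m) :=
        cfcₙ_pow_succ_eq_npow1 hesa m ▸ cfcₙ_predicate _ e
      rw [h₃]
      refine hadd _ _ hsa (cfcₙ_predicate _ x) ?_
      rw [← cfcₙ_pow_succ_eq_npow1 hesa m]
      exact hcomm.cfcₙ_real _
    rw [aux _ hh (by rw [← mul_assoc, hea']) (by rw [mul_assoc, hae]),
      aux _ hk (by rw [← mul_assoc, hea]) (by rw [mul_assoc, hae']),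
      map_cfcₙ_eq_of_map_npow1_eq hτcont hadd hsmul hh hk (map_npow1_star_mul_self htrace a) hq hq0]
  exact ⟨fun f hf hf0 ↦ map_cfcₙ_eq_of_map_npow1_eq hτcont hadd hsmul
    (IsSelfAdjoint.sub hesa hh) (IsSelfAdjoint.sub hesa hk) hpow hf hf0, hpow⟩
end

section
/- Let A and B be C*-algebras and let π : A → B be a surjective *-homomorphism. Assume p, q ∈ B are projections (self-adjoint idempotents) and x ∈ B satisfies p·x = x = x·q. Then there exist elements p̃, q̃ ∈ A with 0 ≤ p̃, 0 ≤ q̃, ‖p̃‖ ≤ 1, ‖q̃‖ ≤ 1, and an element x̃ ∈ A, such that π(p̃) = p, π(q̃) = q, π(x̃) = x, and p̃·x̃ = x̃ = x̃·q̃. Moreover, if p = q, then p̃ and q̃ can be chosen to be equal. -/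
/-- Continuous functional calculus fixes a projection whenever the function fixes `0` and `1`. -/
lemma IsStarProjection.cfcₙ_eq_self {B : Type*} [NonUnitalCStarAlgebra B] {p : B}
    (hp : IsStarProjection p) {f : ℝ → ℝ} (h0 : f 0 = 0) (h1 : f 1 = 1) : cfcₙ f p = p := by
  conv_rhs => rw [← cfcₙ_id ℝ p hp.isSelfAdjoint]
  refine cfcₙ_congr fun t ht => ?_
  have h : t = 0 ∨ t = 1 := by
    simpa using hp.isIdempotentElem.quasispectrum_subset ℝ ht
  rcases h with rfl | rfl <;> simp [h0, h1]

/-- A projection in a quotient C⋆-algebra lifts to a pair of elements `e`, `g` where `e` is a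
positive contraction acting as a two-sided unit on `g`. -/
lemma IsStarProjection.exists_lift_pair {A B : Type*} [NonUnitalCStarAlgebra A]
    [NonUnitalCStarAlgebra B] [PartialOrder A] [StarOrderedRing A]
    (π : A →⋆ₙₐ[ℂ] B) (hπ : Function.Surjective π) {p : B} (hp : IsStarProjection p) :
    ∃ e g : A, 0 ≤ e ∧ ‖e‖ ≤ 1 ∧ π e = p ∧ π g = p ∧ e * g = g ∧ g * e = g := by
  obtain ⟨a, ha⟩ := hπ p
  obtain ⟨h, hh, hπh⟩ : ∃ h : A, IsSelfAdjoint h ∧ π h = p :=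
    ⟨star a * a, .star_mul_self a, by
      rw [map_mul, map_star, ha, hp.isSelfAdjoint.star_eq, hp.isIdempotentElem.eq]⟩
  have hπh' : IsSelfAdjoint (π h) := hπh ▸ hp.isSelfAdjoint
  have hcont : Continuous π :=
    AddMonoidHomClass.continuous_of_bound π 1 fun b => by
      simpa using NonUnitalStarAlgHom.norm_apply_le π b
  let f : ℝ → ℝ := fun t => max 0 (min 1 (2 * t))
  let k : ℝ → ℝ := fun t => max 0 (min 1 (2 * t - 1))
  have hf : Continuous f := by fun_prop
  have hk : Continuous k := by fun_prop
  have hf0 : f 0 = 0 := by simp [f]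
  have hk0 : k 0 = 0 := by simp [k]
  have hf1 : f 1 = 1 := by norm_num [f]
  have hk1 : k 1 = 1 := by norm_num [k]
  have hfk : ∀ t, f t * k t = k t := fun t => by
    rcases le_total (2 * t) 1 with ht | ht
    · have : k t = 0 := max_eq_left ((min_le_right _ _).trans (by linarith))
      simp [this]
    · simp [f, min_eq_left ht]
  refine ⟨cfcₙ f h, cfcₙ k h, cfcₙ_nonneg fun t _ => le_max_left _ _,
    norm_cfcₙ_le fun t _ => ?_, ?_, ?_, ?_, ?_⟩
  · rw [Real.norm_of_nonneg (le_max_left _ _)]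
    exact max_le zero_le_one (min_le_left _ _)
  · rw [NonUnitalStarAlgHomClass.map_cfcₙ π f h hf.continuousOn hf0 hcont hh hπh', hπh, hp.cfcₙ_eq_self hf0 hf1]
  · rw [NonUnitalStarAlgHomClass.map_cfcₙ π k h hk.continuousOn hk0 hcont hh hπh', hπh, hp.cfcₙ_eq_self hk0 hk1]
  · rw [← cfcₙ_mul f k h hf.continuousOn hf0 hk.continuousOn hk0]
    simp only [hfk]
  · rw [← cfcₙ_mul k f h hk.continuousOn hk0 hf.continuousOn hf0]
    simp only [mul_comm (k _), hfk]


/-- Lemma 3.2 of the paper.  Let `π : A → B` be a surjective *-homomorphism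
between C*-algebras, let `p, q ∈ B` be projections and `x ∈ B` with `p x = x = x q`.
Then there are positive contractions `p̃, q̃ ∈ A` and `x̃ ∈ A` lifting `p, q, x` with
`p̃ x̃ = x̃ = x̃ q̃`; moreover if `p = q` then `p̃ = q̃` may be arranged. -/
theorem stmt1 {A B : Type*} [NonUnitalCStarAlgebra A] [NonUnitalCStarAlgebra B]
    [PartialOrder A] [StarOrderedRing A] [PartialOrder B] [StarOrderedRing B]
    (π : A →⋆ₙₐ[ℂ] B) (hπ : Function.Surjective π)
    (p q x : B) (hp : IsSelfAdjoint p ∧ p * p = p) (hq : IsSelfAdjoint q ∧ q * q = q)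
    (hpx : p * x = x) (hxq : x * q = x) :
    ∃ p' q' x' : A, 0 ≤ p' ∧ 0 ≤ q' ∧ ‖p'‖ ≤ 1 ∧ ‖q'‖ ≤ 1 ∧
      π p' = p ∧ π q' = q ∧ π x' = x ∧ p' * x' = x' ∧ x' * q' = x' ∧
      (p = q → p' = q') := by
  choose! e g he hne hπe hπg heg hge using
    fun (r : B) (hr : IsStarProjection r) => hr.exists_lift_pair π hπ
  have hp' : IsStarProjection p := ⟨hp.2, hp.1⟩
  have hq' : IsStarProjection q := ⟨hq.2, hq.1⟩
  obtain ⟨y, hy⟩ := hπ x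
  refine ⟨e p, e q, g p * y * g q, he p hp', he q hq', hne p hp', hne q hq', hπe p hp',
    hπe q hq', ?_, ?_, ?_, fun h => h ▸ rfl⟩
  · rw [map_mul, map_mul, hπg p hp', hπg q hq', hy, hpx, hxq]
  · rw [← mul_assoc, ← mul_assoc, heg p hp']
  · rw [mul_assoc, hge q hq']
end

section
/- Let A be a C*-algebra, let S be a nonempty set of positive linear functionals on A each of norm at most 1, and let a ∈ A with 0 ≤ a. Then for every ε > 0 there exists δ₀ > 0 such that for all δ with 0 < δ < δ₀ one has ω(f_δ(a))|_S < ω(a)|_S + ε. -/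
open scoped ComplexOrder

/-- The cut-off function `f_ε : ℝ → ℝ`: it is `0` on `(-∞, ε/2]`, `1` on `[ε, ∞)`,
and linear on `[ε/2, ε]` (for `ε > 0`). -/
noncomputable def fcut (ε : ℝ) : ℝ → ℝ := fun t => min 1 (max 0 ((t - ε / 2) / (ε / 2)))

variable {A : Type*} [NonUnitalCStarAlgebra A] [PartialOrder A] [StarOrderedRing A]

/-- The hereditary C*-subalgebra generated by `a`, as a subset of `A`:
the norm closure of `{a x a : x ∈ A}`. -/
def herSet (a : A) : Set A := closure {y : A | ∃ x : A, y = a * x * a}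

/-- `d_τ(a) = sup_{ε > 0} τ(f_ε(a))`, the rank of `a` at the positive functional `τ`. -/
noncomputable def dtau (τ : A →L[ℂ] ℂ) (a : A) : ℝ :=
  sSup {r : ℝ | ∃ ε : ℝ, 0 < ε ∧ r = (τ (cfcₙ (fcut ε) a)).re}

/-- The tracial oscillation `ω(a)|_S` of a positive element `a` on a set `S` of
positive functionals:
`inf { sup_{τ ∈ S} (d_τ(a) − τ(c)) : c ∈ Her(a), 0 ≤ c ≤ 1 }`. -/
noncomputable def osc (S : Set (A →L[ℂ] ℂ)) (a : A) : ℝ :=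
  sInf {r : ℝ | ∃ c ∈ herSet a, 0 ≤ c ∧ ‖c‖ ≤ 1 ∧
    r = sSup {s : ℝ | ∃ τ ∈ S, s = dtau τ a - (τ c).re}}

lemma continuous_fcut (ε : ℝ) : Continuous (fcut ε) := by
  unfold fcut
  fun_prop

lemma fcut_nonneg (ε t : ℝ) : 0 ≤ fcut ε t := le_min zero_le_one (le_max_left _ _)

lemma fcut_le_one (ε t : ℝ) : fcut ε t ≤ 1 := min_le_left _ _

lemma fcut_of_le_half {ε t : ℝ} (hε : 0 < ε) (ht : t ≤ ε / 2) : fcut ε t = 0 := by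
  have h : (t - ε / 2) / (ε / 2) ≤ 0 := div_nonpos_of_nonpos_of_nonneg (by linarith) (by linarith)
  simp [fcut, max_eq_left h]

lemma fcut_of_le {ε t : ℝ} (hε : 0 < ε) (ht : ε ≤ t) : fcut ε t = 1 := by
  have h : 1 ≤ (t - ε / 2) / (ε / 2) := by
    rw [le_div_iff₀ (by linarith)]
    linarith
  exact min_eq_left (h.trans (le_max_right _ _))

lemma fcut_zero {ε : ℝ} (hε : 0 < ε) : fcut ε 0 = 0 := fcut_of_le_half hε (by linarith)

lemma norm_cfcₙ_fcut_le (ε : ℝ) (b : A) : ‖cfcₙ (fcut ε) b‖ ≤ 1 :=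
  norm_cfcₙ_le fun t _ => by
    rw [Real.norm_of_nonneg (fcut_nonneg ε t)]
    exact fcut_le_one ε t

lemma cfcₙ_fcut_nonneg (ε : ℝ) (b : A) : 0 ≤ cfcₙ (fcut ε) b :=
  cfcₙ_nonneg fun t _ => fcut_nonneg ε t

lemma abs_re_apply_le_one {E : Type*} [SeminormedAddCommGroup E] [NormedSpace ℂ E]
    {τ : E →L[ℂ] ℂ} (hτ : ‖τ‖ ≤ 1) {x : E} (hx : ‖x‖ ≤ 1) :
    |(τ x).re| ≤ 1 :=
  (Complex.abs_re_le_norm _).trans <| (τ.le_opNorm x).trans <|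
    mul_le_one₀ hτ (norm_nonneg _) hx

lemma re_apply_mono {τ : A →L[ℂ] ℂ} (hτ : ∀ x : A, 0 ≤ τ (star x * x)) {x y : A}
    (hxy : x ≤ y) : (τ x).re ≤ (τ y).re := by
  obtain ⟨z, hz⟩ := CStarAlgebra.nonneg_iff_eq_star_mul_self.mp (sub_nonneg.mpr hxy)
  have h := (Complex.le_def.mp (hτ z)).1
  rw [← hz, map_sub] at h
  simpa using h

lemma bddAbove_dtau {τ : A →L[ℂ] ℂ} (hτ : ‖τ‖ ≤ 1) (b : A) :
    BddAbove {r : ℝ | ∃ ε : ℝ, 0 < ε ∧ r = (τ (cfcₙ (fcut ε) b)).re} := by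
  refine ⟨1, ?_⟩
  rintro _ ⟨ε, -, rfl⟩
  exact (abs_le.mp (abs_re_apply_le_one hτ (norm_cfcₙ_fcut_le ε b))).2

lemma dtau_le_one {τ : A →L[ℂ] ℂ} (hτ : ‖τ‖ ≤ 1) (b : A) : dtau τ b ≤ 1 := by
  refine csSup_le ⟨_, 1, one_pos, rfl⟩ ?_
  rintro _ ⟨ε, -, rfl⟩
  exact (abs_le.mp (abs_re_apply_le_one hτ (norm_cfcₙ_fcut_le ε b))).2

lemma neg_one_le_dtau {τ : A →L[ℂ] ℂ} (hτ : ‖τ‖ ≤ 1) (b : A) : -1 ≤ dtau τ b :=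
  (abs_le.mp (abs_re_apply_le_one hτ (norm_cfcₙ_fcut_le 1 b))).1.trans
    (le_csSup (bddAbove_dtau hτ b) ⟨1, one_pos, rfl⟩)

lemma bddAbove_dtau_sub {S : Set (A →L[ℂ] ℂ)} (hS : ∀ τ ∈ S, ‖τ‖ ≤ 1) (b : A) {c : A}
    (hc : ‖c‖ ≤ 1) : BddAbove {s : ℝ | ∃ τ ∈ S, s = dtau τ b - (τ c).re} := by
  refine ⟨2, ?_⟩
  rintro _ ⟨τ, hτ, rfl⟩
  linarith [dtau_le_one (hS τ hτ) b, (abs_le.mp (abs_re_apply_le_one (hS τ hτ) hc)).1]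

lemma osc_le {S : Set (A →L[ℂ] ℂ)} (hSne : S.Nonempty) (hS : ∀ τ ∈ S, ‖τ‖ ≤ 1) {b c : A}
    (hcb : c ∈ herSet b) (hc₀ : 0 ≤ c) (hc₁ : ‖c‖ ≤ 1) {M : ℝ}
    (hM : ∀ τ ∈ S, dtau τ b - (τ c).re ≤ M) : osc S b ≤ M := by
  obtain ⟨τ, hτ⟩ := hSne
  refine csInf_le_of_le ⟨-2, ?_⟩ ⟨c, hcb, hc₀, hc₁, rfl⟩ (csSup_le ⟨_, τ, hτ, rfl⟩ ?_)
  · rintro _ ⟨d, -, -, hd, rfl⟩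
    refine le_csSup_of_le (bddAbove_dtau_sub hS b hd) ⟨τ, hτ, rfl⟩ ?_
    linarith [neg_one_le_dtau (hS τ hτ) b, (abs_le.mp (abs_re_apply_le_one (hS τ hτ) hd)).2]
  · rintro _ ⟨σ, hσ, rfl⟩
    exact hM σ hσ

lemma exists_of_osc_lt {S : Set (A →L[ℂ] ℂ)} (hS : ∀ τ ∈ S, ‖τ‖ ≤ 1) {b : A} {M : ℝ}
    (hM : osc S b < M) :
    ∃ c ∈ herSet b, 0 ≤ c ∧ ‖c‖ ≤ 1 ∧ ∀ τ ∈ S, dtau τ b - (τ c).re < M := by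
  obtain ⟨_, ⟨c, hcb, hc₀, hc₁, rfl⟩, hlt⟩ := exists_lt_of_csInf_lt
    (by exact ⟨_, 0, subset_closure ⟨0, by simp⟩, le_rfl, by simp, rfl⟩) hM
  exact ⟨c, hcb, hc₀, hc₁, fun τ hτ =>
    (le_csSup (bddAbove_dtau_sub hS b hc₁) ⟨τ, hτ, rfl⟩).trans_lt hlt⟩

lemma dtau_cfcₙ_fcut_le {τ : A →L[ℂ] ℂ} (hτ : ∀ x : A, 0 ≤ τ (star x * x)) (hτ₁ : ‖τ‖ ≤ 1)
    {a : A} (ha : 0 ≤ a) {δ : ℝ} (hδ : 0 < δ) : dtau τ (cfcₙ (fcut δ) a) ≤ dtau τ a := by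
  refine csSup_le ⟨_, 1, one_pos, rfl⟩ ?_
  rintro _ ⟨η, hη, rfl⟩
  refine le_csSup_of_le (bddAbove_dtau hτ₁ a) ⟨δ / 2, half_pos hδ, rfl⟩ (re_apply_mono hτ ?_)
  rw [← cfcₙ_comp (fcut η) (fcut δ) a (continuous_fcut η).continuousOn (fcut_zero hη)
    (continuous_fcut δ).continuousOn (fcut_zero hδ) (IsSelfAdjoint.of_nonneg ha)]
  refine cfcₙ_mono (fun t _ => ?_)
    ((continuous_fcut η).comp (continuous_fcut δ)).continuousOn (continuous_fcut _).continuousOn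
    (by simp [fcut_zero hδ, fcut_zero hη]) (fcut_zero (half_pos hδ))
  rcases le_total t (δ / 2) with h | h
  · simp only [Function.comp, fcut_of_le_half hδ h, fcut_zero hη]
    exact fcut_nonneg _ _
  · rw [fcut_of_le (half_pos hδ) h]
    exact fcut_le_one _ _

lemma abs_fcut_mul_sub_le {δ t : ℝ} (hδ : 0 < δ) (ht : 0 ≤ t) : |fcut δ t * t - t| ≤ δ := by
  rcases le_total δ t with h | h
  · simp [fcut_of_le hδ h, hδ.le]
  · rw [abs_le]
    constructor <;> nlinarith [fcut_nonneg δ t, fcut_le_one δ t]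

lemma norm_cfcₙ_fcut_mul_sub_le {a : A} (ha : 0 ≤ a) {δ : ℝ} (hδ : 0 < δ) :
    ‖cfcₙ (fcut δ) a * a - a‖ ≤ δ := by
  have hsa : IsSelfAdjoint a := IsSelfAdjoint.of_nonneg ha
  have hf := (continuous_fcut δ).continuousOn (s := quasispectrum ℝ a)
  have h : cfcₙ (fcut δ) a * a - a = cfcₙ (fun t => fcut δ t * t - t) a := by
    rw [cfcₙ_sub (fun t => fcut δ t * t) (fun t => t) a (hf.mul continuousOn_id) (by simp)
      continuousOn_id rfl, cfcₙ_mul (fcut δ) (fun t => t) a hf (fcut_zero hδ) continuousOn_id rfl,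
      cfcₙ_id' ℝ a]
  rw [h]
  exact norm_cfcₙ_le fun t ht =>
    abs_fcut_mul_sub_le hδ (quasispectrum_nonneg_of_nonneg a ha t ht)

lemma norm_cfcₙ_fcut_conj_sub_le {a : A} (ha : 0 ≤ a) {δ : ℝ} (hδ : 0 < δ) (x : A) :
    ‖cfcₙ (fcut δ) a * (a * x * a) * cfcₙ (fcut δ) a - a * x * a‖ ≤ 2 * δ * (‖x‖ * ‖a‖) := by
  set g := cfcₙ (fcut δ) a with hg
  have hg₁ : ‖g‖ ≤ 1 := norm_cfcₙ_fcut_le δ a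
  have hl : ‖g * a - a‖ ≤ δ := norm_cfcₙ_fcut_mul_sub_le ha hδ
  have hr : ‖a * g - a‖ ≤ δ := by
    rw [← norm_star]
    simpa [(IsSelfAdjoint.of_nonneg ha).star_eq,
      (IsSelfAdjoint.of_nonneg (cfcₙ_fcut_nonneg δ a)).star_eq, hg] using hl
  have key : g * (a * x * a) * g - a * x * a =
      (g * a - a) * (x * a) * g + a * x * (a * g - a) := by
    noncomm_ring
  have hxa : 0 ≤ ‖x‖ * ‖a‖ := by positivity
  rw [key]
  calc _ ≤ ‖(g * a - a) * (x * a) * g‖ + ‖a * x * (a * g - a)‖ := norm_add_le _ _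
    _ ≤ δ * (‖x‖ * ‖a‖) * 1 + (‖a‖ * ‖x‖) * δ := by
      gcongr
      · exact (norm_mul_le _ _).trans (by
          gcongr
          exact (norm_mul_le _ _).trans (by gcongr; exact norm_mul_le _ _))
      · exact (norm_mul_le _ _).trans (by gcongr; exact norm_mul_le _ _)
    _ = _ := by ring

lemma exists_norm_cfcₙ_fcut_conj_sub_lt {a c : A} (ha : 0 ≤ a) (hc : c ∈ herSet a) {ε : ℝ}
    (hε : 0 < ε) : ∃ δ₀ > 0, ∀ δ : ℝ, 0 < δ → δ < δ₀ →
      ‖cfcₙ (fcut δ) a * c * cfcₙ (fcut δ) a - c‖ < ε := by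
  obtain ⟨_, ⟨x, rfl⟩, hx⟩ := Metric.mem_closure_iff.mp hc (ε / 4) (by linarith)
  rw [dist_eq_norm] at hx
  have hN : 0 < ‖x‖ * ‖a‖ + 1 := by positivity
  refine ⟨ε / (4 * (‖x‖ * ‖a‖ + 1)), by positivity, fun δ hδ hδ' => ?_⟩
  rw [lt_div_iff₀ (by positivity)] at hδ'
  have h₁ := norm_cfcₙ_fcut_conj_sub_le ha hδ x
  have hg₁ : ‖cfcₙ (fcut δ) a‖ ≤ 1 := norm_cfcₙ_fcut_le δ a
  set g := cfcₙ (fcut δ) a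
  set y := a * x * a
  have h₂ : ‖g * (c - y) * g‖ ≤ ‖c - y‖ :=
    calc _ ≤ ‖g‖ * ‖c - y‖ * ‖g‖ := (norm_mul_le _ _).trans (by gcongr; exact norm_mul_le _ _)
      _ ≤ 1 * ‖c - y‖ * 1 := by gcongr
      _ = _ := by ring
  have key : g * c * g - c = g * (c - y) * g + (g * y * g - y) - (c - y) := by
    noncomm_ring
  rw [key]
  have h₃ := norm_sub_le (g * (c - y) * g + (g * y * g - y)) (c - y)
  have h₄ := norm_add_le (g * (c - y) * g) (g * y * g - y)
  linarith

/-- Lemma 4.3 of the paper.  Let `S` be a nonempty set of positive linear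
functionals on a C*-algebra `A`, each of norm at most `1`, and let `0 ≤ a`.  Then for every
`ε > 0` there is `δ₀ > 0` such that `ω(f_δ(a))|_S < ω(a)|_S + ε` for all `0 < δ < δ₀`. -/
theorem stmt2 (S : Set (A →L[ℂ] ℂ)) (hSne : S.Nonempty)
    (hSpos : ∀ τ ∈ S, ∀ x : A, 0 ≤ τ (star x * x))
    (hSnorm : ∀ τ ∈ S, ‖τ‖ ≤ 1)
    (a : A) (ha : 0 ≤ a) :
    ∀ ε > 0, ∃ δ₀ > 0, ∀ δ : ℝ, 0 < δ → δ < δ₀ →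
      osc S (cfcₙ (fcut δ) a) < osc S a + ε := by
  intro ε hε
  obtain ⟨c, hca, hc₀, hc₁, hc⟩ :=
    exists_of_osc_lt hSnorm (show osc S a < osc S a + ε / 3 by linarith)
  obtain ⟨δ₀, hδ₀, h⟩ := exists_norm_cfcₙ_fcut_conj_sub_lt ha hca (show 0 < ε / 3 by linarith)
  refine ⟨δ₀, hδ₀, fun δ hδ hδ' => ?_⟩
  have hconj := h δ hδ hδ'
  have hdtau : ∀ τ ∈ S, dtau τ (cfcₙ (fcut δ) a) ≤ dtau τ a := fun τ hτ =>
    dtau_cfcₙ_fcut_le (hSpos τ hτ) (hSnorm τ hτ) ha hδ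
  have hg₀ := cfcₙ_fcut_nonneg δ a
  have hg₁ := norm_cfcₙ_fcut_le δ a
  set g := cfcₙ (fcut δ) a
  have hnorm : ‖g * c * g‖ ≤ 1 :=
    calc _ ≤ ‖g‖ * ‖c‖ * ‖g‖ := (norm_mul_le _ _).trans (by gcongr; exact norm_mul_le _ _)
      _ ≤ 1 * 1 * 1 := by gcongr
      _ = 1 := by norm_num
  have hle : osc S g ≤ osc S a + 2 * (ε / 3) := by
    refine osc_le hSne hSnorm (subset_closure ⟨c, rfl⟩)
      ((IsSelfAdjoint.of_nonneg hg₀).conjugate_nonneg hc₀) hnorm fun τ hτ => ?_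
    have h₁ : |(τ (g * c * g - c)).re| ≤ ‖g * c * g - c‖ :=
      (Complex.abs_re_le_norm _).trans <| (τ.le_opNorm _).trans <|
        mul_le_of_le_one_left (norm_nonneg _) (hSnorm τ hτ)
    rw [map_sub, Complex.sub_re] at h₁
    linarith [hdtau τ hτ, hc τ hτ, (abs_le.mp h₁).1]
  linarith
end

section
/- Let R be a unital C*-algebra and let y ∈ R. Then the 2×2 matrix with upper-left entry y and all other entries 0 lies in the norm closure of the set of invertible elements of M₂(R). In particular, dist(diag(y, 0), GL(M₂(R))) = 0. -/
-- Equip `M₂(R)` with the (L∞-operator) norm; its topology coincides with that of the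
-- unique C*-norm on `M₂(R)`, so closure of the invertibles is the usual one.
attribute [local instance] Matrix.linftyOpNormedRing

/-- An antidiagonal perturbation of `diag(y, 0)` by a nonzero scalar is invertible. -/
theorem isUnit_diagonal_add_smul_antidiagonal {K A : Type*} [Field K] [Ring A] [Algebra K A]
    (y : A) {t : K} (ht : t ≠ 0) :
    IsUnit (Matrix.diagonal ![y, 0] + t • !![0, 1; 1, 0] : Matrix (Fin 2) (Fin 2) A) := by
  refine isUnit_iff_exists.2
    ⟨t⁻¹ • !![0, 1; 1, 0] - Matrix.diagonal ![0, (t⁻¹ * t⁻¹) • y], ?_, ?_⟩ <;>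
  · rw [Matrix.diagonal_fin_two, Matrix.diagonal_fin_two]
    simp [Matrix.smul_of, Matrix.one_fin_two, smul_smul, ht]

/-- (the claim in the proof of Lemma 8.7 of the paper).  For a unital
C*-algebra `R` and `y ∈ R`, the matrix `diag(y, 0) ∈ M₂(R)` lies in the norm closure of
the invertible elements of `M₂(R)`; in particular its distance to `GL(M₂(R))` is `0`. -/
theorem stmt10 {R : Type*} [CStarAlgebra R] (y : R) :
    Matrix.diagonal ![y, 0] ∈
        closure {m : Matrix (Fin 2) (Fin 2) R | IsUnit m} ∧
      Metric.infDist (Matrix.diagonal ![y, 0])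
        {m : Matrix (Fin 2) (Fin 2) R | IsUnit m} = 0 := by
  have hmem : Matrix.diagonal ![y, 0] ∈
      closure {m : Matrix (Fin 2) (Fin 2) R | IsUnit m} := by
    let _ : NormedAlgebra ℂ (Matrix (Fin 2) (Fin 2) R) := Matrix.linftyOpNormedAlgebra
    have hcont : Continuous fun t : ℂ =>
        (Matrix.diagonal ![y, 0] + t • !![0, 1; 1, 0] : Matrix (Fin 2) (Fin 2) R) :=
      continuous_const.add (continuous_id.smul continuous_const)
    have hlim := (hcont.tendsto 0).mono_left (nhdsWithin_le_nhds (s := {0}ᶜ))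
    rw [zero_smul, add_zero] at hlim
    refine mem_closure_of_tendsto hlim ?_
    filter_upwards [self_mem_nhdsWithin] with t ht
    exact isUnit_diagonal_add_smul_antidiagonal y ht
  exact ⟨hmem, (Metric.mem_closure_iff_infDist_zero ⟨1, isUnit_one⟩).1 hmem⟩
end

section
/- Let A be a C*-algebra such that every element of A, viewed inside the unitization à = ℂ ⊕ A, lies in the norm closure of the invertible elements of Ã. Then for every integer n ≥ 1, every a ∈ M_n(A), and every ε > 0, there exist matrices x, y ∈ M_n(A) with x_{i,j} = 0 whenever i < j and y_{i,j} = 0 whenever i > j, such that ‖a − x·y‖ < ε in M_n(A). -/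
-- Equip `Mₙ(A)` with the (L∞-operator) norm; its topology coincides with that of the
-- unique C*-norm on `Mₙ(A)`.
attribute [local instance] Matrix.linftyOpNonUnitalNormedRing

/-- If every element of `A` is a limit of invertibles of the unitization, then every matrix over `A`
is entrywise approximated by products of a lower and an upper triangular matrix over the
unitization. -/
theorem exists_triangular_mul_approx_unitization {A : Type*} [NonUnitalCStarAlgebra A]
    (hA : ∀ a : A, (a : Unitization ℂ A) ∈ closure {u : Unitization ℂ A | IsUnit u})
    {ε : ℝ} (hε : 0 < ε) (n : ℕ) (a : Matrix (Fin n) (Fin n) A) :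
    ∃ l r : Matrix (Fin n) (Fin n) (Unitization ℂ A),
      (∀ i j, i < j → l i j = 0) ∧ (∀ i j, j < i → r i j = 0) ∧
      ∀ i j, ‖(a i j : Unitization ℂ A) - (l * r) i j‖ < ε := by
  induction n with
  | zero => exact ⟨0, 0, fun i => i.elim0, fun i => i.elim0, fun i => i.elim0⟩
  | succ n ih =>
    obtain ⟨_, ⟨u, rfl⟩, hu⟩ := Metric.mem_closure_iff.mp (hA (a 0 0)) ε hε
    rw [dist_eq_norm] at hu
    have hschur (x y z : A) : ∃ d : A, (d : Unitization ℂ A) = x - y * ↑u⁻¹ * z :=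
      CanLift.prf _ (by rw [sub_eq_add_neg]; simp)
    choose d hd using hschur
    obtain ⟨l, r, hl, hr, hlr⟩ := ih (Matrix.of fun i j => d (a i.succ j.succ) (a i.succ 0) (a 0 j.succ))
    refine ⟨Matrix.of (Fin.cons (Fin.cons 1 0)
        fun i => Fin.cons (a i.succ 0 * ↑u⁻¹) (l i)),
      Matrix.of (Fin.cons (Fin.cons ↑u fun j => (a 0 j.succ : Unitization ℂ A))
        fun i => Fin.cons 0 (r i)), ?_, ?_, ?_⟩
    · intro i j
      refine Fin.cases ?_ (fun i => ?_) i <;> refine Fin.cases ?_ (fun j => ?_) j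
      · simp
      · simp
      · simp
      · simpa using hl i j
    · intro i j
      refine Fin.cases ?_ (fun i => ?_) i <;> refine Fin.cases ?_ (fun j => ?_) j
      · simp
      · simp
      · simp
      · simpa using hr i j
    · intro i j
      refine Fin.cases ?_ (fun i => ?_) i <;> refine Fin.cases ?_ (fun j => ?_) j
      · simpa [Matrix.mul_apply, Fin.sum_univ_succ] using hu
      · simpa [Matrix.mul_apply, Fin.sum_univ_succ] using hε
      · simpa [Matrix.mul_apply, Fin.sum_univ_succ] using hε
      · have h := hlr i j
        rw [Matrix.of_apply, hd, sub_sub, Matrix.mul_apply] at h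
        simpa [Matrix.mul_apply, Fin.sum_univ_succ] using h

/-- A finite family in a C⋆-algebra is approximately fixed by a two-sided compression. -/
theorem exists_norm_sub_mul_mul_lt {A ι : Type*} [NonUnitalCStarAlgebra A] [Finite ι]
    (a : ι → A) {ε : ℝ} (hε : 0 < ε) :
    ∃ e f : A, ∀ i, ‖a i - e * a i * f‖ < ε := by
  let := CStarAlgebra.spectralOrder A
  have := CStarAlgebra.spectralOrderedRing A
  have happ := CStarAlgebra.increasingApproximateUnit A
  have := happ.neBot
  have hleft : ∀ᶠ e in CStarAlgebra.approximateUnit A, ∀ i, ‖a i - e * a i‖ < ε / 2 := by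
    refine Filter.eventually_all.mpr fun i => ?_
    filter_upwards [Metric.tendsto_nhds.mp (happ.tendsto_mul_right (a i)) (ε / 2) (half_pos hε)]
      with e he
    rwa [← dist_eq_norm, dist_comm]
  obtain ⟨e, he⟩ := hleft.exists
  have hright : ∀ᶠ f in CStarAlgebra.approximateUnit A,
      ∀ i, ‖e * a i - e * a i * f‖ < ε / 2 := by
    refine Filter.eventually_all.mpr fun i => ?_
    filter_upwards [Metric.tendsto_nhds.mp (happ.tendsto_mul_left (e * a i)) (ε / 2) (half_pos hε)]
      with f hf
    rwa [← dist_eq_norm, dist_comm]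
  obtain ⟨f, hf⟩ := hright.exists
  refine ⟨e, f, fun i => ?_⟩
  calc ‖a i - e * a i * f‖ ≤ ‖a i - e * a i‖ + ‖e * a i - e * a i * f‖ :=
        norm_sub_le_norm_sub_add_norm_sub _ _ _
    _ < ε := by linarith [he i, hf i]

/-- A matrix with uniformly small entries has small `L∞`-operator norm. -/
theorem Matrix.linfty_opNorm_lt_of_forall_norm_lt {A : Type*} [NonUnitalNormedRing A] {n : ℕ}
    {m : Matrix (Fin n) (Fin n) A} {ε : ℝ} (hε : 0 < ε)
    (h : ∀ i j, ‖m i j‖ < ε / (n + 1)) : ‖m‖ < ε := by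
  rw [Matrix.linfty_opNorm_def, ← NNReal.coe_mk ε hε.le, NNReal.coe_lt_coe,
    Finset.sup_lt_iff (by exact_mod_cast hε)]
  intro i _
  rw [← NNReal.coe_lt_coe]
  push_cast
  calc ∑ j, ‖m i j‖ ≤ ∑ _j : Fin n, ε / (n + 1) := Finset.sum_le_sum fun j _ => (h i j).le
    _ = n * (ε / (n + 1)) := by simp
    _ < ε := by
      rw [mul_div_assoc', div_lt_iff₀ (by positivity)]
      nlinarith

/-- Proposition 9.1 of the paper.  Let `A` be a C*-algebra such that every
element of `A` lies in the norm closure of the invertibles of the unitization `Ã`.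
Then every `a ∈ Mₙ(A)` can be approximated in norm, to any tolerance `ε > 0`, by a
product `x y` with `x` upper triangular (`x i j = 0` for `i < j`) and `y` lower
triangular (`y i j = 0` for `i > j`), `x, y ∈ Mₙ(A)`. -/
theorem stmt12 {A : Type*} [NonUnitalCStarAlgebra A]
    (hA : ∀ a : A, (a : Unitization ℂ A) ∈ closure {u : Unitization ℂ A | IsUnit u}) :
    ∀ n : ℕ, 1 ≤ n → ∀ a : Matrix (Fin n) (Fin n) A, ∀ ε > (0 : ℝ),
      ∃ x y : Matrix (Fin n) (Fin n) A,
        (∀ i j : Fin n, i < j → x i j = 0) ∧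
        (∀ i j : Fin n, j < i → y i j = 0) ∧
        ‖a - x * y‖ < ε := by
  intro n _ a ε hε
  have hδ : 0 < ε / (n + 1) / 2 := by positivity
  obtain ⟨e, f, hef⟩ := exists_norm_sub_mul_mul_lt (fun p : Fin n × Fin n => a p.1 p.2) hδ
  have hc : 0 < ‖e‖ * ‖f‖ + 1 := by positivity
  obtain ⟨l, r, hl, hr, hlr⟩ :=
    exists_triangular_mul_approx_unitization hA (div_pos hδ hc) n a
  have hx (i j : Fin n) : ∃ z : A, (z : Unitization ℂ A) = e * l i j :=
    CanLift.prf _ (by simp)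
  have hy (i j : Fin n) : ∃ z : A, (z : Unitization ℂ A) = r i j * f :=
    CanLift.prf _ (by simp)
  choose x hx using hx
  choose y hy using hy
  refine ⟨Matrix.of x, Matrix.of y, fun i j hij => ?_, fun i j hij => ?_,
    Matrix.linfty_opNorm_lt_of_forall_norm_lt hε fun i j => ?_⟩
  · apply Unitization.inr_injective (R := ℂ)
    simp [hx, hl i j hij]
  · apply Unitization.inr_injective (R := ℂ)
    simp [hy, hr i j hij]
  · have hprod : (((Matrix.of x * Matrix.of y) i j : A) : Unitization ℂ A) =
        e * (l * r) i j * f := by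
      rw [Matrix.mul_apply, Matrix.mul_apply, Finset.mul_sum, Finset.sum_mul,
        ← Unitization.inrHom_apply ℂ ℂ A, map_sum]
      simp [hx, hy, mul_assoc]
    have hmid : ‖e * a i j * f - (Matrix.of x * Matrix.of y) i j‖ < ε / (n + 1) / 2 := by
      rw [← Unitization.norm_inr (𝕜 := ℂ), Unitization.inr_sub, hprod, Unitization.inr_mul,
        Unitization.inr_mul, ← sub_mul, ← mul_sub]
      calc _ ≤ ‖(e : Unitization ℂ A)‖ * ‖(a i j : Unitization ℂ A) - (l * r) i j‖ *
              ‖(f : Unitization ℂ A)‖ :=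
            (norm_mul_le _ _).trans (by gcongr; exact norm_mul_le _ _)
        _ = (‖e‖ * ‖f‖) * ‖(a i j : Unitization ℂ A) - (l * r) i j‖ := by
            rw [Unitization.norm_inr, Unitization.norm_inr]; ring
        _ ≤ (‖e‖ * ‖f‖) * (ε / (n + 1) / 2 / (‖e‖ * ‖f‖ + 1)) := by
            gcongr; exact (hlr i j).le
        _ < ε / (n + 1) / 2 := by
            rw [mul_div_assoc', div_lt_iff₀ hc]
            nlinarith
    rw [Matrix.sub_apply]
    linarith [hef (i, j), hmid, norm_sub_le_norm_sub_add_norm_sub (a i j) (e * a i j * f)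
      ((Matrix.of x * Matrix.of y) i j)]
end
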